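/- arXiv:0808.3746 — 7 statements merged into one kernel-verified Lean document; each statement's English description precedes it below -/
import Mathlib

section
/- Let Δ ∈ (0,1] and let (P_n)_{n≥1} be a sequence of finitely supported Borel probability measures on [0,1] such that for every n any two distinct points of the set supp(P_n) ∪ {0,1} are at distance at least Δ. Define ω_n = 0 if P_n((1/2,1]) > 1/2 and ω_n = 1 otherwise, and g_n(p) = (2·𝟙{p ≤ 1/2} − 1)(ω_n − p). Then for every sequence (p_n)_{n≥1} of points of [0,1], the Skeptic capital K_n := (1/2)·Σ_{k=1}^∞ 2^{-k}(A_n^k + B_n^k) + Σ_{k=1}^∞ 2^{-k} F_n^k satisfies limsup_{n→∞} K_n = ∞, where A_n^k = ∏_{j=1}^n (1 − 2^{-k}·𝟙{p_j > 1/2}·(ω_j − p_j)), B_n^k = ∏_{j=1}^n (1 + 2^{-k}·𝟙{p_j ≤ 1/2}·(ω_j − p_j)), and F_n^k = ∏_{j=1}^n (1 − 2^{-k}·(g_j(p_j) − ∫ g_j dP_j)). -/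
open Finset Filter

/-- The mean of `g` is at least `Δ/2` and at most `1`. -/
lemma mean_bounds (Δ : ℝ) (P : ℝ →₀ ℝ)
    (hpos : ∀ x, 0 ≤ P x)
    (hsupp : (P.support : Set ℝ) ⊆ Set.Icc (0 : ℝ) 1)
    (hsum : ∑ x ∈ P.support, P x = 1)
    (hsep : ∀ x ∈ P.support ∪ ({0, 1} : Finset ℝ),
        ∀ y ∈ P.support ∪ ({0, 1} : Finset ℝ), x ≠ y → Δ ≤ |x - y|)
    (w : ℝ)
    (hw : w = if 1 / 2 < ∑ x ∈ P.support.filter (fun x => 1 / 2 < x), P x then 0 else 1)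
    (g : ℝ → ℝ)
    (hg : ∀ q, g q = (2 * (if q ≤ 1 / 2 then (1 : ℝ) else 0) - 1) * (w - q)) :
    Δ / 2 ≤ ∑ x ∈ P.support, P x * g x ∧ ∑ x ∈ P.support, P x * g x ≤ 1 := by
  set S : Finset ℝ := P.support ∪ ({0, 1} : Finset ℝ) with hS
  have hSI : ∀ x ∈ S, 0 ≤ x ∧ x ≤ 1 := by
    intro x hx
    simp only [hS, Finset.mem_union, Finset.mem_insert, Finset.mem_singleton] at hx
    rcases hx with hx | hx | hx
    · exact hsupp hx
    · subst hx; norm_num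
    · subst hx; norm_num
  obtain ⟨b, hb, hbmax⟩ := Finset.exists_max_image (S.filter (fun x => x ≤ 1 / 2)) id
    ⟨0, by simp [hS]⟩
  obtain ⟨a, ha, hamin⟩ := Finset.exists_min_image (S.filter (fun x => 1 / 2 < x)) id
    ⟨1, by simp [hS]; norm_num⟩
  rw [Finset.mem_filter] at ha hb
  have hab : Δ ≤ a - b := by
    have h1 : a ≠ b := by intro h; linarith [ha.2, hb.2]
    have := hsep a ha.1 b hb.1 h1
    rwa [abs_of_pos (by linarith [ha.2, hb.2])] at this
  obtain ⟨ha0, ha1⟩ := hSI a ha.1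
  obtain ⟨hb0, hb1⟩ := hSI b hb.1
  have hb' : ∀ x ∈ P.support, x ≤ 1 / 2 → x ≤ b := fun x hx h =>
    hbmax x (Finset.mem_filter.2 ⟨Finset.mem_union_left _ hx, h⟩)
  have ha' : ∀ x ∈ P.support, 1 / 2 < x → a ≤ x := fun x hx h =>
    hamin x (Finset.mem_filter.2 ⟨Finset.mem_union_left _ hx, h⟩)
  set m := ∑ x ∈ P.support.filter (fun x => 1 / 2 < x), P x with hm
  have hm' : m = ∑ x ∈ P.support, P x * (if 1 / 2 < x then 1 else 0) := by
    rw [hm, Finset.sum_filter]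
    apply Finset.sum_congr rfl
    intro x _
    split_ifs <;> simp
  have hw01 : w = 0 ∨ w = 1 := by rw [hw]; split_ifs <;> simp
  have hlin : ∀ u v : ℝ, ∑ x ∈ P.support, P x * (u + v * (if 1 / 2 < x then 1 else 0))
      = u + v * m := by
    intro u v
    rw [hm', Finset.mul_sum]
    calc _ = ∑ x ∈ P.support, (P x * u + v * (P x * (if 1 / 2 < x then 1 else 0))) := by
          apply Finset.sum_congr rfl; intro x _; ring
      _ = _ := by rw [Finset.sum_add_distrib, ← Finset.sum_mul, hsum, one_mul]
  constructor
  · by_cases hc : 1 / 2 < m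
    · rw [if_pos hc] at hw
      have key : ∑ x ∈ P.support, P x * (-b + (a + b) * (if 1 / 2 < x then 1 else 0))
          ≤ ∑ x ∈ P.support, P x * g x := by
        apply Finset.sum_le_sum
        intro x hx
        apply mul_le_mul_of_nonneg_left _ (hpos x)
        rw [hg, hw]
        by_cases h : 1 / 2 < x
        · rw [if_pos h, if_neg (not_le.2 h)]; linarith [ha' x hx h]
        · rw [if_neg h, if_pos (not_lt.1 h)]; linarith [hb' x hx (not_lt.1 h)]
      rw [hlin] at key
      nlinarith
    · rw [if_neg hc] at hw
      have key : ∑ x ∈ P.support,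
          P x * ((1 - b) + (-(1 - a) - (1 - b)) * (if 1 / 2 < x then 1 else 0))
          ≤ ∑ x ∈ P.support, P x * g x := by
        apply Finset.sum_le_sum
        intro x hx
        apply mul_le_mul_of_nonneg_left _ (hpos x)
        rw [hg, hw]
        by_cases h : 1 / 2 < x
        · rw [if_pos h, if_neg (not_le.2 h)]; linarith [ha' x hx h]
        · rw [if_neg h, if_pos (not_lt.1 h)]; linarith [hb' x hx (not_lt.1 h)]
      rw [hlin] at key
      nlinarith
  · rw [← hsum]
    apply Finset.sum_le_sum
    intro x hx
    have hxI := hsupp hx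
    have : g x ≤ 1 := by
      rw [hg]
      rcases hw01 with h | h <;> rw [h] <;> split_ifs <;> linarith [hxI.1, hxI.2]
    nlinarith [hpos x]

/-- A term of a dominated geometric series of nonnegative terms is at most its sum. -/
lemma term_le_tsum (M : ℝ) (f : ℕ → ℝ) (h0 : ∀ k, 0 ≤ f k) (h1 : ∀ k, f k ≤ M) (k : ℕ) :
    (1 / 2 : ℝ) ^ (k + 1) * f k ≤ ∑' k : ℕ, (1 / 2 : ℝ) ^ (k + 1) * f k := by
  have hs : Summable (fun k : ℕ => (1 / 2 : ℝ) ^ (k + 1) * f k) := by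
    apply Summable.of_nonneg_of_le (fun k => mul_nonneg (by positivity) (h0 k))
      (fun k => mul_le_mul_of_nonneg_left (h1 k) (by positivity))
    apply Summable.mul_right
    exact (summable_nat_add_iff 1).2 summable_geometric_two
  exact hs.le_tsum k (fun j _ => mul_nonneg (by positivity) (h0 j))

/-- Game-theoretic version of Oakes' example (Theorem 2 of the paper), in explicit
deterministic form. `P n` is Forecaster's finitely supported forecast distribution on
`[0,1]` at round `n` (represented by its weight function `ℝ →₀ ℝ`), whose support
together with `{0,1}` is `Δ`-separated; `ω n` is Reality's adversarial outcome
(`ω n = 0` if `P n((1/2,1]) > 1/2`, else `ω n = 1`);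
`g n p = (2·𝟙{p ≤ 1/2} − 1)(ω n − p)`; `p n ∈ [0,1]` is Random Number Generator's move.
With the accounts `A n k`, `B n k`, `F n k` (here `ε_k = (1/2)^k`, `k = 1, 2, …`),
Skeptic's total capital
`K n = (1/2)·∑_{k≥1} 2^{-k}(A n k + B n k) + ∑_{k≥1} 2^{-k}·F n k`
satisfies `limsup K n = ∞`, i.e. `K n` exceeds any bound infinitely often. -/
theorem skeptic_capital_unbounded
    (Δ : ℝ) (hΔ : Δ ∈ Set.Ioc (0 : ℝ) 1)
    (P : ℕ → (ℝ →₀ ℝ))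
    (hpos : ∀ n x, 0 ≤ P n x)
    (hsupp : ∀ n, ((P n).support : Set ℝ) ⊆ Set.Icc (0 : ℝ) 1)
    (hsum : ∀ n, ∑ x ∈ (P n).support, P n x = 1)
    (hsep : ∀ n, ∀ x ∈ (P n).support ∪ ({0, 1} : Finset ℝ),
        ∀ y ∈ (P n).support ∪ ({0, 1} : Finset ℝ), x ≠ y → Δ ≤ |x - y|)
    (ω : ℕ → ℝ)
    (hω : ∀ n, ω n =
      if 1 / 2 < ∑ x ∈ (P n).support.filter (fun x => 1 / 2 < x), P n x then 0 else 1)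
    (g : ℕ → ℝ → ℝ)
    (hg : ∀ n q, g n q = (2 * (if q ≤ 1 / 2 then (1 : ℝ) else 0) - 1) * (ω n - q))
    (p : ℕ → ℝ) (hp : ∀ n, p n ∈ Set.Icc (0 : ℝ) 1)
    (A B F : ℕ → ℕ → ℝ)
    (hA : ∀ n k, A n k = ∏ j ∈ Finset.range n,
        (1 - (1 / 2 : ℝ) ^ k * (if 1 / 2 < p j then (1 : ℝ) else 0) * (ω j - p j)))
    (hB : ∀ n k, B n k = ∏ j ∈ Finset.range n,
        (1 + (1 / 2 : ℝ) ^ k * (if p j ≤ 1 / 2 then (1 : ℝ) else 0) * (ω j - p j)))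
    (hF : ∀ n k, F n k = ∏ j ∈ Finset.range n,
        (1 - (1 / 2 : ℝ) ^ k * (g j (p j) - ∑ x ∈ (P j).support, P j x * g j x)))
    (K : ℕ → ℝ)
    (hK : ∀ n, K n =
        (1 / 2) * (∑' k : ℕ, (1 / 2 : ℝ) ^ (k + 1) * (A n (k + 1) + B n (k + 1)))
          + ∑' k : ℕ, (1 / 2 : ℝ) ^ (k + 1) * F n (k + 1)) :
    ∀ C : ℝ, ∃ᶠ n in atTop, C < K n := by
  obtain ⟨hΔ0, hΔ1⟩ := hΔ
  set G : ℕ → ℝ := fun j => ∑ x ∈ (P j).support, P j x * g j x with hGdef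
  have hG : ∀ j, Δ / 2 ≤ G j ∧ G j ≤ 1 := fun j =>
    mean_bounds Δ (P j) (hpos j) (hsupp j) (hsum j) (hsep j) (ω j) (hω j) (g j) (hg j)
  have hF' : ∀ n k, F n k = ∏ j ∈ Finset.range n,
      (1 - (1 / 2 : ℝ) ^ k * (g j (p j) - G j)) := hF
  have hω01 : ∀ j, ω j = 0 ∨ ω j = 1 := by
    intro j; rw [hω]; split_ifs <;> simp
  have hwp : ∀ j, -1 ≤ ω j - p j ∧ ω j - p j ≤ 1 := by
    intro j
    have := hp j
    rcases hω01 j with h | h <;> rw [h] <;> constructor <;> linarith [this.1, this.2]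
  have hgb : ∀ j, -1 ≤ g j (p j) ∧ g j (p j) ≤ 1 := by
    intro j
    have := hwp j
    rw [hg]
    split_ifs <;> constructor <;> linarith [this.1, this.2]
  have heps : ∀ k : ℕ, 0 < (1 / 2 : ℝ) ^ (k + 1) ∧ (1 / 2 : ℝ) ^ (k + 1) ≤ 1 / 2 := by
    intro k
    refine ⟨by positivity, ?_⟩
    rw [pow_succ]
    have : (1 / 2 : ℝ) ^ k ≤ 1 := pow_le_one₀ (by norm_num) (by norm_num)
    linarith
  have fA : ∀ k j, 0 ≤ (1 - (1 / 2 : ℝ) ^ (k + 1) * (if 1 / 2 < p j then (1 : ℝ) else 0)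
      * (ω j - p j)) ∧ (1 - (1 / 2 : ℝ) ^ (k + 1) * (if 1 / 2 < p j then (1 : ℝ) else 0)
      * (ω j - p j)) ≤ 2 := by
    intro k j
    obtain ⟨e0, e1⟩ := heps k
    obtain ⟨w0, w1⟩ := hwp j
    split_ifs <;> constructor <;> nlinarith
  have fB : ∀ k j, 0 ≤ (1 + (1 / 2 : ℝ) ^ (k + 1) * (if p j ≤ 1 / 2 then (1 : ℝ) else 0)
      * (ω j - p j)) ∧ (1 + (1 / 2 : ℝ) ^ (k + 1) * (if p j ≤ 1 / 2 then (1 : ℝ) else 0)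
      * (ω j - p j)) ≤ 2 := by
    intro k j
    obtain ⟨e0, e1⟩ := heps k
    obtain ⟨w0, w1⟩ := hwp j
    split_ifs <;> constructor <;> nlinarith
  have fF : ∀ k j, 0 ≤ (1 - (1 / 2 : ℝ) ^ (k + 1) * (g j (p j) - G j)) ∧
      (1 - (1 / 2 : ℝ) ^ (k + 1) * (g j (p j) - G j)) ≤ 2 := by
    intro k j
    obtain ⟨e0, e1⟩ := heps k
    obtain ⟨w0, w1⟩ := hgb j
    obtain ⟨G0, G1⟩ := hG j
    have h1 : -2 ≤ g j (p j) - G j := by linarith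
    have h2 : g j (p j) - G j ≤ 2 := by linarith
    constructor <;> nlinarith
  have prod_b : ∀ (n : ℕ) (f : ℕ → ℝ), (∀ j, 0 ≤ f j ∧ f j ≤ 2) →
      0 ≤ ∏ j ∈ Finset.range n, f j ∧ ∏ j ∈ Finset.range n, f j ≤ 2 ^ n := by
    intro n f hf
    refine ⟨Finset.prod_nonneg (fun j _ => (hf j).1), ?_⟩
    calc _ ≤ ∏ j ∈ Finset.range n, (2 : ℝ) :=
          Finset.prod_le_prod (fun j _ => (hf j).1) (fun j _ => (hf j).2)
      _ = _ := by simp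
  have bA : ∀ n k, 0 ≤ A n (k + 1) ∧ A n (k + 1) ≤ 2 ^ n := by
    intro n k; rw [hA]; exact prod_b n _ (fA k)
  have bB : ∀ n k, 0 ≤ B n (k + 1) ∧ B n (k + 1) ≤ 2 ^ n := by
    intro n k; rw [hB]; exact prod_b n _ (fB k)
  have bF : ∀ n k, 0 ≤ F n (k + 1) ∧ F n (k + 1) ≤ 2 ^ n := by
    intro n k; rw [hF']; exact prod_b n _ (fF k)
  obtain ⟨k, hk⟩ : ∃ k : ℕ, (1 / 2 : ℝ) ^ (k + 1) ≤ Δ / 8 := by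
    obtain ⟨k, hk⟩ := exists_pow_lt_of_lt_one (show 0 < Δ / 8 by linarith)
      (show (1 / 2 : ℝ) < 1 by norm_num)
    refine ⟨k, ?_⟩
    rw [pow_succ]
    have : (0 : ℝ) < (1 / 2 : ℝ) ^ k := by positivity
    linarith
  obtain ⟨e0, e1⟩ := heps k
  have lowK : ∀ n, (1 / 2) * ((1 / 2 : ℝ) ^ (k + 1) * (A n (k + 1) + B n (k + 1)))
      + (1 / 2 : ℝ) ^ (k + 1) * F n (k + 1) ≤ K n := by
    intro n
    rw [hK]
    have h1 := term_le_tsum (2 ^ n + 2 ^ n) (fun k => A n (k + 1) + B n (k + 1))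
      (fun k => add_nonneg (bA n k).1 (bB n k).1)
      (fun k => add_le_add (bA n k).2 (bB n k).2) k
    have h2 := term_le_tsum (2 ^ n) (fun k => F n (k + 1))
      (fun k => (bF n k).1) (fun k => (bF n k).2) k
    linarith
  have lowP : ∀ n, (1 + (1 / 2 : ℝ) ^ (k + 1) * (Δ / 4)) ^ n
      ≤ A n (k + 1) * B n (k + 1) * F n (k + 1) := by
    intro n
    rw [hA, hB, hF', ← Finset.prod_mul_distrib, ← Finset.prod_mul_distrib]
    generalize (1 / 2 : ℝ) ^ (k + 1) = e at *
    calc _ = ∏ j ∈ Finset.range n, (1 + e * (Δ / 4)) := by simp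
      _ ≤ _ := by
        apply Finset.prod_le_prod
        · intro j _; positivity
        · intro j _
          obtain ⟨w0, w1⟩ := hgb j
          obtain ⟨G0, G1⟩ := hG j
          have hAB : (1 - e * (if 1 / 2 < p j then (1 : ℝ) else 0) * (ω j - p j)) *
              (1 + e * (if p j ≤ 1 / 2 then (1 : ℝ) else 0) * (ω j - p j))
              = 1 + e * g j (p j) := by
            rw [hg]
            by_cases h : 1 / 2 < p j
            · rw [if_pos h, if_neg (not_le.2 h)]; ring
            · rw [if_neg h, if_pos (not_lt.1 h)]; ring
          rw [hAB]
          have h2 : g j (p j) * (g j (p j) - G j) ≤ 2 := by nlinarith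
          have h3 : e * (g j (p j) * (g j (p j) - G j)) ≤ Δ / 4 := by nlinarith
          have h4 : 0 ≤ e * (G j - e * (g j (p j) * (g j (p j) - G j)) - Δ / 4) :=
            mul_nonneg e0.le (by linarith)
          nlinarith
  intro C
  apply Filter.Eventually.frequently
  set D := max C 0 with hD
  set e := (1 / 2 : ℝ) ^ (k + 1) with he
  have ht : Tendsto (fun n : ℕ => (1 + e * (Δ / 4)) ^ n) atTop atTop :=
    tendsto_pow_atTop_atTop_of_one_lt (by have := mul_pos e0 hΔ0; linarith)
  filter_upwards [ht.eventually_gt_atTop ((2 * D / e) * (2 * D / e) * (2 * D / e))] with n hn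
  by_contra hcon
  have hKD : K n ≤ D := (not_lt.1 hcon).trans (le_max_left _ _)
  have hD0 : 0 ≤ D := le_max_right _ _
  have hl := lowK n
  obtain ⟨A0, -⟩ := bA n k
  obtain ⟨B0, -⟩ := bB n k
  obtain ⟨F0, -⟩ := bF n k
  have mA := mul_nonneg e0.le A0
  have mB := mul_nonneg e0.le B0
  have mF := mul_nonneg e0.le F0
  have hA1 : A n (k + 1) ≤ 2 * D / e := by rw [le_div_iff₀ e0]; linarith
  have hB1 : B n (k + 1) ≤ 2 * D / e := by rw [le_div_iff₀ e0]; linarith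
  have hF1 : F n (k + 1) ≤ 2 * D / e := by rw [le_div_iff₀ e0]; linarith
  have hX : 0 ≤ 2 * D / e := by positivity
  have : A n (k + 1) * B n (k + 1) * F n (k + 1) ≤ (2 * D / e) * (2 * D / e) * (2 * D / e) :=
    mul_le_mul (mul_le_mul hA1 hB1 B0 hX) hF1 F0 (mul_nonneg hX hX)
  linarith [lowP n]
end

section
/- Let Δ ∈ (0,1] and let (P_n)_{n≥1} be a sequence of finitely supported Borel probability measures on [0,1] such that for every n any two distinct points of supp(P_n) ∪ {0,1} are at distance at least Δ. Define ω_n = 0 if P_n((1/2,1]) > 1/2 and ω_n = 1 otherwise, and g_n(p) = (2·𝟙{p ≤ 1/2} − 1)(ω_n − p). Let (p_n)_{n≥1} be a sequence in [0,1] and suppose that for every k ≥ 1 the sequence F_n^k = ∏_{j=1}^n (1 − 2^{-k}·(g_j(p_j) − ∫ g_j dP_j)) is bounded above (uniformly in n). Set θ_{n,1} = Σ_{j=1}^n 𝟙{p_j > 1/2}·(ω_j − p_j) and θ_{n,2} = Σ_{j=1}^n 𝟙{p_j ≤ 1/2}·(ω_j − p_j). Then limsup_{n→∞} |θ_{n,i}/n|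 ≥ Δ/4 for i = 1 or for i = 2. -/
open Finset Filter

lemma aux_log (x : ℝ) (hx : |x| ≤ 1 / 2) : -x - 2 * x ^ 2 ≤ Real.log (1 - x) := by
  obtain ⟨h1, h2⟩ := abs_le.1 hx
  have hpos : 0 < 1 - x := by linarith
  refine le_trans ?_ (Real.one_sub_inv_le_log_of_pos hpos)
  have h : 1 - (1 - x)⁻¹ - (-x - 2 * x ^ 2) = x ^ 2 * (1 - 2 * x) / (1 - x) := by
    field_simp
    ring
  have h3 : 0 ≤ x ^ 2 * (1 - 2 * x) / (1 - x) :=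
    div_nonneg (mul_nonneg (sq_nonneg _) (by linarith)) hpos.le
  linarith

/-- The adversarial outcome forces the expected value of `g` to be at least `Δ / 2`. -/
lemma aux_mean (Δ : ℝ) (hΔ : Δ ∈ Set.Ioc (0 : ℝ) 1) (P : ℝ →₀ ℝ)
    (hpos : ∀ x, 0 ≤ P x)
    (hsum : ∑ x ∈ P.support, P x = 1)
    (hsep : ∀ x ∈ P.support ∪ ({0, 1} : Finset ℝ),
        ∀ y ∈ P.support ∪ ({0, 1} : Finset ℝ), x ≠ y → Δ ≤ |x - y|)
    (ω : ℝ)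
    (hω : ω = if 1 / 2 < ∑ x ∈ P.support.filter (fun x => 1 / 2 < x), P x then 0 else 1) :
    Δ / 2 ≤ ∑ x ∈ P.support,
      P x * ((2 * (if x ≤ 1 / 2 then (1 : ℝ) else 0) - 1) * (ω - x)) := by
  obtain ⟨hΔ0, hΔ1⟩ := hΔ
  set S := (P.support ∪ ({0, 1} : Finset ℝ)).filter (fun x => x ≤ 1 / 2) with hS
  have h0 : (0 : ℝ) ∈ S := by simp [hS]
  set M := S.max' ⟨0, h0⟩ with hM
  have hMS : M ∈ S := S.max'_mem _
  have hM0 : 0 ≤ M := S.le_max' _ h0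
  obtain ⟨hMmem, hMhalf⟩ := Finset.mem_filter.1 hMS
  have hlow : ∀ x ∈ P.support, x ≤ 1 / 2 → x ≤ M := fun x hx hx2 =>
    S.le_max' _ (Finset.mem_filter.2 ⟨Finset.mem_union_left _ hx, hx2⟩)
  have hhigh : ∀ x ∈ P.support, 1 / 2 < x → M + Δ ≤ x := by
    intro x hx hx2
    have := hsep x (Finset.mem_union_left _ hx) M hMmem (by linarith)
    rw [abs_of_pos (by linarith)] at this
    linarith
  set a := ∑ x ∈ P.support.filter (fun x => 1 / 2 < x), P x with ha
  have ha' : a = ∑ x ∈ P.support, P x * (if 1 / 2 < x then 1 else 0) := by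
    rw [ha, Finset.sum_filter]
    exact Finset.sum_congr rfl fun x _ => by split_ifs <;> simp
  have ha0 : 0 ≤ a := Finset.sum_nonneg fun x _ => hpos x
  by_cases hc : 1 / 2 < a
  · rw [if_pos hc] at hω
    subst hω
    have key : ∑ x ∈ P.support, (P x * (if 1 / 2 < x then 1 else 0) * (2 * M + Δ) - P x * M)
        ≤ ∑ x ∈ P.support,
          P x * ((2 * (if x ≤ 1 / 2 then (1 : ℝ) else 0) - 1) * (0 - x)) := by
      refine Finset.sum_le_sum fun x hx => ?_
      by_cases h : x ≤ 1 / 2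
      · rw [if_pos h, if_neg (not_lt.2 h)]
        nlinarith [hpos x, hlow x hx h, mul_le_mul_of_nonneg_left (hlow x hx h) (hpos x)]
      · rw [if_neg h, if_pos (not_le.1 h)]
        nlinarith [mul_le_mul_of_nonneg_left (hhigh x hx (not_le.1 h)) (hpos x)]
    rw [Finset.sum_sub_distrib, ← Finset.sum_mul, ← Finset.sum_mul, ← ha', hsum] at key
    nlinarith
  · rw [if_neg hc] at hω
    subst hω
    have key : ∑ x ∈ P.support,
        (P x * (1 - M) - P x * (if 1 / 2 < x then 1 else 0) * (2 * (1 - M) - Δ))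
        ≤ ∑ x ∈ P.support,
          P x * ((2 * (if x ≤ 1 / 2 then (1 : ℝ) else 0) - 1) * (1 - x)) := by
      refine Finset.sum_le_sum fun x hx => ?_
      by_cases h : x ≤ 1 / 2
      · rw [if_pos h, if_neg (not_lt.2 h)]
        nlinarith [mul_le_mul_of_nonneg_left (hlow x hx h) (hpos x)]
      · rw [if_neg h, if_pos (not_le.1 h)]
        nlinarith [mul_le_mul_of_nonneg_left (hhigh x hx (not_le.1 h)) (hpos x)]
    rw [Finset.sum_sub_distrib, ← Finset.sum_mul, ← Finset.sum_mul, ← ha', hsum] at key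
    push Not at hc
    nlinarith [mul_nonneg (show 0 ≤ 1 - 2 * a by linarith) (show 0 ≤ 1 - M - Δ / 2 by linarith)]

lemma aux_bdd (f : ℕ → ℝ) (hf : ∀ j, |f j| ≤ 1) :
    IsBoundedUnder (· ≤ ·) atTop
      (fun n : ℕ => |(∑ j ∈ Finset.range n, f j) / (n : ℝ)|) := by
  refine isBoundedUnder_of ⟨1, fun n => ?_⟩
  have h : |∑ j ∈ Finset.range n, f j| ≤ n := by
    refine (Finset.abs_sum_le_sum_abs _ _).trans ?_
    refine (Finset.sum_le_sum fun j _ => hf j).trans ?_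
    simp
  rw [abs_div, Nat.abs_cast]
  exact div_le_one_of_le₀ h (Nat.cast_nonneg n)


/-- Corollary of the paper: a lower bound on the calibration error. `P n` is
Forecaster's finitely supported forecast distribution on `[0,1]` at round `n`
(represented by its weight function `ℝ →₀ ℝ`), whose support together with `{0,1}`
is `Δ`-separated; `ω n` is Reality's adversarial outcome (`ω n = 0` if
`P n((1/2,1]) > 1/2`, else `ω n = 1`); `g n p = (2·𝟙{p ≤ 1/2} − 1)(ω n − p)`.
If for every `k ≥ 1` the randomness-test capital
`F n k = ∏_{j<n} (1 − 2^{-k}(g j (p j) − ∫ g j dP j))` is bounded above uniformly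
in `n`, then the calibration errors `θ_{n,1} = ∑_{j<n} 𝟙{p j > 1/2}(ω j − p j)` and
`θ_{n,2} = ∑_{j<n} 𝟙{p j ≤ 1/2}(ω j − p j)` satisfy
`limsup |θ_{n,i}/n| ≥ Δ/4` for `i = 1` or `i = 2`. -/
theorem calibration_lower_bound
    (Δ : ℝ) (hΔ : Δ ∈ Set.Ioc (0 : ℝ) 1)
    (P : ℕ → (ℝ →₀ ℝ))
    (hpos : ∀ n x, 0 ≤ P n x)
    (hsupp : ∀ n, ((P n).support : Set ℝ) ⊆ Set.Icc (0 : ℝ) 1)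
    (hsum : ∀ n, ∑ x ∈ (P n).support, P n x = 1)
    (hsep : ∀ n, ∀ x ∈ (P n).support ∪ ({0, 1} : Finset ℝ),
        ∀ y ∈ (P n).support ∪ ({0, 1} : Finset ℝ), x ≠ y → Δ ≤ |x - y|)
    (ω : ℕ → ℝ)
    (hω : ∀ n, ω n =
      if 1 / 2 < ∑ x ∈ (P n).support.filter (fun x => 1 / 2 < x), P n x then 0 else 1)
    (g : ℕ → ℝ → ℝ)
    (hg : ∀ n q, g n q = (2 * (if q ≤ 1 / 2 then (1 : ℝ) else 0) - 1) * (ω n - q))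
    (p : ℕ → ℝ) (hp : ∀ n, p n ∈ Set.Icc (0 : ℝ) 1)
    (F : ℕ → ℕ → ℝ)
    (hF : ∀ n k, F n k = ∏ j ∈ Finset.range n,
        (1 - (1 / 2 : ℝ) ^ k * (g j (p j) - ∑ x ∈ (P j).support, P j x * g j x)))
    (hFbdd : ∀ k ≥ 1, ∃ C : ℝ, ∀ n, F n k ≤ C)
    (θ₁ θ₂ : ℕ → ℝ)
    (hθ₁ : ∀ n, θ₁ n = ∑ j ∈ Finset.range n,
        (if 1 / 2 < p j then (1 : ℝ) else 0) * (ω j - p j))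
    (hθ₂ : ∀ n, θ₂ n = ∑ j ∈ Finset.range n,
        (if p j ≤ 1 / 2 then (1 : ℝ) else 0) * (ω j - p j)) :
    Δ / 4 ≤ limsup (fun n : ℕ => |θ₁ n / (n : ℝ)|) atTop
      ∨ Δ / 4 ≤ limsup (fun n : ℕ => |θ₂ n / (n : ℝ)|) atTop := by
  have hω01 : ∀ n, 0 ≤ ω n ∧ ω n ≤ 1 := by
    intro n
    rw [hω n]
    split_ifs <;> norm_num
  have hg1 : ∀ n q, q ∈ Set.Icc (0 : ℝ) 1 → |g n q| ≤ 1 := by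
    intro n q hq
    obtain ⟨h1, h2⟩ := hω01 n
    obtain ⟨h3, h4⟩ := hq
    rw [hg n q, abs_le]
    split_ifs <;> constructor <;> linarith
  set m : ℕ → ℝ := fun j => ∑ x ∈ (P j).support, P j x * g j x with hm
  have hmean : ∀ j, Δ / 2 ≤ m j := by
    intro j
    have := aux_mean Δ hΔ (P j) (hpos j) (hsum j) (hsep j) (ω j) (hω j)
    simpa only [hm, hg] using this
  have hm1 : ∀ j, |m j| ≤ 1 := by
    intro j
    refine (Finset.abs_sum_le_sum_abs _ _).trans ?_
    rw [← hsum j]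
    refine Finset.sum_le_sum fun x hx => ?_
    rw [abs_mul, abs_of_nonneg (hpos j x)]
    exact mul_le_of_le_one_right (hpos j x) (hg1 j x (hsupp j hx))
  have hd : ∀ j, |g j (p j) - m j| ≤ 2 := by
    intro j
    have h1 := abs_le.1 (hg1 j (p j) (hp j))
    have h2 := abs_le.1 (hm1 j)
    rw [abs_le]
    constructor <;> linarith [h1.1, h1.2, h2.1, h2.2]
  have hθ : ∀ n, θ₂ n - θ₁ n = ∑ j ∈ Finset.range n, g j (p j) := by
    intro n
    rw [hθ₁, hθ₂, ← Finset.sum_sub_distrib]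
    refine Finset.sum_congr rfl fun j _ => ?_
    rw [hg]
    by_cases h : p j ≤ 1 / 2
    · rw [if_pos h, if_neg (not_lt.2 h)]; ring
    · rw [if_neg h, if_pos (not_le.1 h)]; ring
  have hb₁ : IsBoundedUnder (· ≤ ·) atTop (fun n : ℕ => |θ₁ n / (n : ℝ)|) := by
    simp only [hθ₁]
    refine aux_bdd _ fun j => ?_
    obtain ⟨h1, h2⟩ := hω01 j
    obtain ⟨h3, h4⟩ := hp j
    rw [abs_le]
    split_ifs <;> constructor <;> linarith
  have hb₂ : IsBoundedUnder (· ≤ ·) atTop (fun n : ℕ => |θ₂ n / (n : ℝ)|) := by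
    simp only [hθ₂]
    refine aux_bdd _ fun j => ?_
    obtain ⟨h1, h2⟩ := hω01 j
    obtain ⟨h3, h4⟩ := hp j
    rw [abs_le]
    split_ifs <;> constructor <;> linarith
  by_contra hcon
  push Not at hcon
  obtain ⟨hl₁, hl₂⟩ := hcon
  obtain ⟨c₁, hc₁, hc₁'⟩ := exists_between hl₁
  obtain ⟨c₂, hc₂, hc₂'⟩ := exists_between hl₂
  have he₁ := eventually_lt_of_limsup_lt hc₁ hb₁
  have he₂ := eventually_lt_of_limsup_lt hc₂ hb₂
  set δ := Δ / 2 - c₁ - c₂ with hδ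
  have hδ0 : 0 < δ := by linarith
  obtain ⟨k₀, hk₀⟩ := exists_pow_lt_of_lt_one (show 0 < δ / 16 by linarith)
    (show (1 / 2 : ℝ) < 1 by norm_num)
  set k := k₀ + 2 with hk
  set ε := (1 / 2 : ℝ) ^ k with hε
  have hε0 : 0 < ε := by positivity
  have hε2 : ε = (1 / 2 : ℝ) ^ k₀ / 4 := by rw [hε, hk, pow_add]; norm_num; ring
  have hε4 : ε ≤ 1 / 4 := by
    rw [hε2]
    have : (1 / 2 : ℝ) ^ k₀ ≤ 1 := pow_le_one₀ (by norm_num) (by norm_num)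
    linarith
  have hεδ : ε < δ / 16 := by
    have : 0 < (1 / 2 : ℝ) ^ k₀ := by positivity
    rw [hε2]; linarith
  obtain ⟨C, hC⟩ := hFbdd k (by omega)
  have hx : ∀ j, |ε * (g j (p j) - m j)| ≤ 1 / 2 := by
    intro j
    rw [abs_mul, abs_of_pos hε0]
    nlinarith [hd j, abs_nonneg (g j (p j) - m j)]
  have hlog : ∀ n, Real.log (F n k)
      = ∑ j ∈ Finset.range n, Real.log (1 - ε * (g j (p j) - m j)) := by
    intro n
    rw [hF n k, Real.log_prod]
    intro j _
    have := (abs_le.1 (hx j)).2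
    have h2 : 0 < 1 - ε * (g j (p j) - m j) := by linarith
    exact h2.ne'
  have hFpos : ∀ n, 0 < F n k := by
    intro n
    rw [hF n k]
    refine Finset.prod_pos fun j _ => ?_
    have := (abs_le.1 (hx j)).2
    have h2 : 0 < 1 - ε * (g j (p j) - m j) := by linarith
    exact h2
  have hmain : ∀ n : ℕ, -(ε * (θ₂ n - θ₁ n)) + ε * (n * (Δ / 2)) - 8 * ε ^ 2 * n
      ≤ Real.log C := by
    intro n
    refine le_trans ?_ (Real.log_le_log (hFpos n) (hC n))
    rw [hlog n, hθ n]
    have h1 : ∑ j ∈ Finset.range n, (-(ε * g j (p j)) + (ε * (Δ / 2) - 8 * ε ^ 2))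
        ≤ ∑ j ∈ Finset.range n, Real.log (1 - ε * (g j (p j) - m j)) := by
      refine Finset.sum_le_sum fun j _ => ?_
      refine le_trans ?_ (aux_log _ (hx j))
      have h2 : (g j (p j) - m j) ^ 2 ≤ 4 := by
        have := sq_le_sq' (abs_le.1 (hd j)).1 (abs_le.1 (hd j)).2
        linarith
      have h3 : ε ^ 2 * (g j (p j) - m j) ^ 2 ≤ ε ^ 2 * 4 :=
        mul_le_mul_of_nonneg_left h2 (sq_nonneg _)
      have h4 := mul_le_mul_of_nonneg_left (hmean j) hε0.le
      rw [mul_pow]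
      linarith
    rw [Finset.sum_add_distrib, Finset.sum_neg_distrib, ← Finset.mul_sum, Finset.sum_const,
      Finset.card_range, nsmul_eq_mul] at h1
    linarith
  obtain ⟨N, hN⟩ := exists_nat_gt (Real.log C / (ε * (δ / 2)))
  obtain ⟨n, ⟨⟨h1, h2⟩, h3⟩, h4⟩ := (((he₁.and he₂).and (eventually_ge_atTop N)).and
    (eventually_gt_atTop 0)).exists
  have hn0 : (0 : ℝ) < n := Nat.cast_pos.2 h4
  have hNn : (N : ℝ) ≤ n := Nat.cast_le.2 h3
  rw [abs_div, Nat.abs_cast, div_lt_iff₀ hn0] at h1 h2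
  have h5 : θ₂ n - θ₁ n ≤ (c₁ + c₂) * n := by
    have := neg_abs_le (θ₁ n)
    have := le_abs_self (θ₂ n)
    linarith
  have h6 := hmain n
  have h7 : Real.log C < n * (ε * (δ / 2)) := by
    rw [← div_lt_iff₀ (by positivity)]
    linarith
  have h8 := mul_le_mul_of_nonneg_left h5 hε0.le
  have h9 : 8 * ε * (ε * n) ≤ δ / 2 * (ε * n) :=
    mul_le_mul_of_nonneg_right (by linarith) (by positivity)
  have h10 : ε * (n * (Δ / 2)) - ε * ((c₁ + c₂) * n) = δ * (ε * n) := by rw [hδ]; ring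
  nlinarith
end

section
/- Let P be a finitely supported Borel probability measure on [0,1], let D = supp(P) ∪ {0,1}, let p⁻ = max{x ∈ D : x ≤ 1/2} and p⁺ = min{x ∈ D : x > 1/2}, and let ω = 0 if P((1/2,1]) > 1/2 and ω = 1 otherwise. Then ∫ (2·𝟙{p ≤ 1/2} − 1)(ω − p) dP(p) ≥ (p⁺ − p⁻)/2. -/
open Finset

/-- Per-round expectation estimate: for a finitely supported probability measure `P`
on `[0,1]` (represented by its weight function, a finitely supported `ℝ →₀ ℝ`),
with `D = supp(P) ∪ {0,1}`, `p⁻ = max {x ∈ D : x ≤ 1/2}`, `p⁺ = min {x ∈ D : x > 1/2}`,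
and the adversarial outcome `ω = 0` if `P((1/2,1]) > 1/2`, `ω = 1` otherwise, one has
`∫ (2·𝟙{p ≤ 1/2} − 1)(ω − p) dP(p) ≥ (p⁺ − p⁻)/2`. -/
theorem integral_g_ge_gap_div_two
    (P : ℝ →₀ ℝ)
    (hpos : ∀ x, 0 ≤ P x)
    (hsupp : (P.support : Set ℝ) ⊆ Set.Icc (0 : ℝ) 1)
    (hsum : ∑ x ∈ P.support, P x = 1)
    (D : Finset ℝ) (hD : D = P.support ∪ ({0, 1} : Finset ℝ))
    (pm pp : ℝ)
    (hpm : IsGreatest {x : ℝ | x ∈ D ∧ x ≤ 1 / 2} pm)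
    (hpp : IsLeast {x : ℝ | x ∈ D ∧ 1 / 2 < x} pp)
    (ω : ℝ)
    (hω : ω = if 1 / 2 < ∑ x ∈ P.support.filter (fun x => 1 / 2 < x), P x then 0 else 1) :
    (pp - pm) / 2 ≤
      ∑ x ∈ P.support, P x * ((2 * (if x ≤ 1 / 2 then (1 : ℝ) else 0) - 1) * (ω - x)) := by
  have hpm0 : 0 ≤ pm := hpm.2 ⟨by rw [hD]; simp, by norm_num⟩
  have hpm2 : pm ≤ 1 / 2 := hpm.1.2
  have hpp1 : pp ≤ 1 := hpp.2 ⟨by rw [hD]; simp, by norm_num⟩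
  have hpp2 : 1 / 2 < pp := hpp.1.2
  have key : ∑ x ∈ P.support, ((ω - pm) * P x
        + (pp + pm - 2 * ω) * (if 1 / 2 < x then P x else 0)) ≤
      ∑ x ∈ P.support, P x * ((2 * (if x ≤ 1 / 2 then (1 : ℝ) else 0) - 1) * (ω - x)) := by
    apply Finset.sum_le_sum
    intro x hx
    have hxD : x ∈ D := by rw [hD]; exact Finset.mem_union_left _ hx
    have h0 := hpos x
    by_cases h : x ≤ 1 / 2
    · have h1 : x ≤ pm := hpm.2 ⟨hxD, h⟩
      rw [if_pos h, if_neg (not_lt.mpr h)]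
      nlinarith [mul_nonneg h0 (sub_nonneg.mpr h1)]
    · have h2 : pp ≤ x := hpp.2 ⟨hxD, not_le.mp h⟩
      rw [if_neg h, if_pos (not_le.mp h)]
      nlinarith [mul_nonneg h0 (sub_nonneg.mpr h2)]
  refine le_trans ?_ key
  rw [Finset.sum_add_distrib, ← Finset.mul_sum, ← Finset.mul_sum, hsum, ← Finset.sum_filter]
  generalize ∑ x ∈ P.support.filter (fun x => 1 / 2 < x), P x = q at *
  split_ifs at hω with hq
  · subst hω
    nlinarith [mul_nonneg (sub_nonneg.mpr hq.le) (by linarith : 0 ≤ pp + pm)]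
  · subst hω
    nlinarith [mul_nonneg (sub_nonneg.mpr (not_lt.mp hq)) (by linarith : 0 ≤ 2 - pp - pm)]
end

section
/- Let Δ ∈ (0,1] and let (P_n)_{n≥1} be a sequence of finitely supported Borel probability measures on [0,1] such that for every n, with D_n = supp(P_n) ∪ {0,1}, p_n⁻ = max{x ∈ D_n : x ≤ 1/2} and p_n⁺ = min{x ∈ D_n : x > 1/2}, one has p_n⁺ − p_n⁻ ≥ Δ. Define ω_n = 0 if P_n((1/2,1]) > 1/2 and ω_n = 1 otherwise, and g_n(p) = (2·𝟙{p ≤ 1/2} − 1)(ω_n − p). Let (p_n)_{n≥1} be a sequence in [0,1], let 0 < ε ≤ 1/4, and suppose that the products ∏_{j=1}^n (1 − ε·(g_j(p_j) − ∫ g_j dP_j)) are bounded above uniformly in n. Then there exists N such that for all n ≥ N, (1/n)·Σ_{j=1}^n g_j(p_j) ≥ Δ/2 − 2ε. -/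
open Finset

theorem log_aux (ε d : ℝ) (hε : 0 < ε) (hε' : ε ≤ 1 / 4) (h1 : -(3/2) ≤ d) (h2 : d ≤ 1) :
    0 < 1 - ε * d ∧ -(ε * d) - 4 / 3 * ε ^ 2 ≤ Real.log (1 - ε * d) := by
  have hp : 0 < 1 - ε * d := by nlinarith
  refine ⟨hp, ?_⟩
  rcases le_total 0 d with hd | hd
  · have h := Real.one_sub_inv_le_log_of_pos hp
    refine le_trans ?_ h
    have h34 : 3 / 4 ≤ 1 - ε * d := by nlinarith
    have ht : 0 ≤ ε * d := by positivity
    have ht' : ε * d ≤ ε := by nlinarith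
    have e : 1 - (1 - ε * d)⁻¹ = -(ε * d) - (ε * d) ^ 2 / (1 - ε * d) := by
      field_simp
      ring
    rw [e]
    have : (ε * d) ^ 2 / (1 - ε * d) ≤ 4 / 3 * ε ^ 2 := by
      rw [div_le_iff₀ hp]
      nlinarith [sq_nonneg ε]
    linarith
  · have hs : 0 ≤ -(ε * d) := by nlinarith
    have h := Real.le_log_one_add_of_nonneg hs
    rw [← sub_eq_add_neg] at h
    refine le_trans ?_ h
    have hs' : -(ε * d) ≤ 3 / 2 * ε := by nlinarith
    rw [le_div_iff₀ (by linarith)]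
    generalize -(ε * d) = s at *
    nlinarith [sq_nonneg ε, mul_nonneg hs (sq_nonneg ε)]

theorem int_lower (P : ℝ →₀ ℝ) (hpos : ∀ x, 0 ≤ P x) (hsum : ∑ x ∈ P.support, P x = 1)
    (g : ℝ → ℝ) (a b : ℝ)
    (h : ∀ x ∈ P.support, a + b * (if 1 / 2 < x then 1 else 0) ≤ g x) :
    a + b * ∑ x ∈ P.support.filter (fun x => 1 / 2 < x), P x ≤ ∑ x ∈ P.support, P x * g x := by
  calc a + b * ∑ x ∈ P.support.filter (fun x => 1 / 2 < x), P x
      = ∑ x ∈ P.support, P x * (a + b * (if 1 / 2 < x then 1 else 0)) := by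
        simp only [mul_add, Finset.sum_add_distrib, ← Finset.sum_mul, hsum, one_mul]
        rw [Finset.sum_filter, Finset.mul_sum]
        congr 1
        refine Finset.sum_congr rfl fun x _ => ?_
        split_ifs <;> ring
    _ ≤ _ := Finset.sum_le_sum fun x hx => mul_le_mul_of_nonneg_left (h x hx) (hpos x)

/-- Inequality (oo-1): if Forecaster's finitely supported forecast distributions `P n`
on `[0,1]` have gap `p_n⁺ − p_n⁻ ≥ Δ` (where `p_n⁻ = max {x ∈ D_n : x ≤ 1/2}` and
`p_n⁺ = min {x ∈ D_n : x > 1/2}` with `D_n = supp(P_n) ∪ {0,1}`), `ω_n` is Reality's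
adversarial outcome, `g_n(p) = (2·𝟙{p ≤ 1/2} − 1)(ω_n − p)`, and the capital process
`∏_{j<n} (1 − ε·(g_j(p_j) − ∫ g_j dP_j))` is bounded above uniformly in `n`, then
eventually `(1/n)·∑_{j<n} g_j(p_j) ≥ Δ/2 − 2ε`. -/
theorem eventually_avg_g_ge
    (Δ : ℝ) (hΔ : Δ ∈ Set.Ioc (0 : ℝ) 1)
    (P : ℕ → (ℝ →₀ ℝ))
    (hpos : ∀ n x, 0 ≤ P n x)
    (hsupp : ∀ n, ((P n).support : Set ℝ) ⊆ Set.Icc (0 : ℝ) 1)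
    (hsum : ∀ n, ∑ x ∈ (P n).support, P n x = 1)
    (D : ℕ → Finset ℝ) (hD : ∀ n, D n = (P n).support ∪ ({0, 1} : Finset ℝ))
    (pm pp : ℕ → ℝ)
    (hpm : ∀ n, IsGreatest {x : ℝ | x ∈ D n ∧ x ≤ 1 / 2} (pm n))
    (hpp : ∀ n, IsLeast {x : ℝ | x ∈ D n ∧ 1 / 2 < x} (pp n))
    (hgap : ∀ n, Δ ≤ pp n - pm n)
    (ω : ℕ → ℝ)
    (hω : ∀ n, ω n =
      if 1 / 2 < ∑ x ∈ (P n).support.filter (fun x => 1 / 2 < x), P n x then 0 else 1)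
    (g : ℕ → ℝ → ℝ)
    (hg : ∀ n q, g n q = (2 * (if q ≤ 1 / 2 then (1 : ℝ) else 0) - 1) * (ω n - q))
    (p : ℕ → ℝ) (hp : ∀ n, p n ∈ Set.Icc (0 : ℝ) 1)
    (ε : ℝ) (hε : 0 < ε) (hε' : ε ≤ 1 / 4)
    (hbdd : ∃ C : ℝ, ∀ n, ∏ j ∈ Finset.range n,
        (1 - ε * (g j (p j) - ∑ x ∈ (P j).support, P j x * g j x)) ≤ C) :
    ∃ N : ℕ, ∀ n ≥ N,
      Δ / 2 - 2 * ε ≤ (1 / (n : ℝ)) * ∑ j ∈ Finset.range n, g j (p j) := by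
  have hgb : ∀ n q, q ∈ Set.Icc (0 : ℝ) 1 → -(1/2) ≤ g n q ∧ g n q ≤ 1 := by
    rintro n q ⟨h0, h1⟩
    rw [hg, hω]
    split_ifs <;> constructor <;> linarith
  have hI1 : ∀ n, ∑ x ∈ (P n).support, P n x * g n x ≤ 1 := by
    intro n
    rw [← hsum n]
    refine Finset.sum_le_sum fun x hx => ?_
    have := (hgb n x (hsupp n hx)).2
    nlinarith [hpos n x]
  have hI2 : ∀ n, Δ / 2 ≤ ∑ x ∈ (P n).support, P n x * g n x := by
    intro n
    have m0 : 0 ≤ pm n := (hpm n).2 ⟨by simp [hD], by norm_num⟩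
    have m1 : pm n ≤ 1 / 2 := (hpm n).1.2
    have q0 : 1 / 2 < pp n := (hpp n).1.2
    have q1 : pp n ≤ 1 := (hpp n).2 ⟨by simp [hD], by norm_num⟩
    have hm : ∀ x ∈ (P n).support, x ≤ 1 / 2 → x ≤ pm n := fun x hx h =>
      (hpm n).2 ⟨by rw [hD]; exact Finset.mem_union_left _ hx, h⟩
    have hq : ∀ x ∈ (P n).support, 1 / 2 < x → pp n ≤ x := fun x hx h =>
      (hpp n).2 ⟨by rw [hD]; exact Finset.mem_union_left _ hx, h⟩
    have hgn := hgap n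
    by_cases hA : 1 / 2 < ∑ x ∈ (P n).support.filter (fun x => 1 / 2 < x), P n x
    · have := int_lower (P n) (hpos n) (hsum n) (g n) (-pm n) (pp n + pm n) (by
        intro x hx
        rw [hg, hω, if_pos hA]
        by_cases h : 1 / 2 < x
        · rw [if_pos h, if_neg (not_le.2 h)]
          linarith [hq x hx h]
        · rw [if_neg h, if_pos (not_lt.1 h)]
          linarith [hm x hx (not_lt.1 h)])
      nlinarith
    · have := int_lower (P n) (hpos n) (hsum n) (g n) (1 - pm n) (-(1 - pp n) - (1 - pm n)) (by
        intro x hx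
        rw [hg, hω, if_neg hA]
        by_cases h : 1 / 2 < x
        · rw [if_pos h, if_neg (not_le.2 h)]
          linarith [hq x hx h]
        · rw [if_neg h, if_pos (not_lt.1 h)]
          linarith [hm x hx (not_lt.1 h)])
      nlinarith
  obtain ⟨C, hC⟩ := hbdd
  have key : ∀ j, _ := fun j => log_aux ε (g j (p j) - ∑ x ∈ (P j).support, P j x * g j x) hε hε'
    (by linarith [(hgb j (p j) (hp j)).1, hI1 j])
    (by linarith [(hgb j (p j) (hp j)).2, hI2 j, hΔ.1])
  obtain ⟨N, hN⟩ := exists_nat_ge (Real.log C / (2 / 3 * ε ^ 2))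
  refine ⟨N + 1, fun n hn => ?_⟩
  have hn0 : (0 : ℝ) < n := by exact_mod_cast (by omega : 0 < n)
  have hNn : (N : ℝ) ≤ n := by exact_mod_cast (by omega : N ≤ n)
  have hlogC : Real.log C ≤ n * (2 / 3 * ε ^ 2) :=
    (div_le_iff₀ (by positivity)).1 (hN.trans hNn)
  have h1 := Real.log_le_log (Finset.prod_pos fun j _ => (key j).1) (hC n)
  rw [Real.log_prod (fun j _ => (key j).1.ne')] at h1
  have h2 : ∑ j ∈ Finset.range n, (ε * (Δ / 2) - ε * g j (p j) - 4 / 3 * ε ^ 2) ≤ Real.log C := by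
    refine le_trans (Finset.sum_le_sum fun j _ => ?_) h1
    refine le_trans ?_ (key j).2
    nlinarith [mul_le_mul_of_nonneg_left (hI2 j) hε.le]
  simp only [Finset.sum_sub_distrib, Finset.sum_const, Finset.card_range, nsmul_eq_mul,
    ← Finset.mul_sum] at h2
  rw [one_div, inv_mul_eq_div, le_div_iff₀ hn0]
  refine le_of_mul_le_mul_left ?_ hε
  nlinarith
end

section
/- Let (a_j)_{j≥1} and (b_j)_{j≥1} be sequences of real numbers with |a_j| ≤ 1 and |b_j| ≤ 1 for all j, let δ > 0, and suppose there exists N such that (1/n)·Σ_{j=1}^n (b_j − a_j) ≥ δ for all n ≥ N. Then for every ε with 0 < ε ≤ 1/2, limsup_{n→∞} (1/n)·( ln ∏_{j=1}^n (1 − ε·a_j) + ln ∏_{j=1}^n (1 + ε·b_j) ) ≥ ε·δ − 2ε². In particular, if in addition ε ≤ δ/8, then limsup_{n→∞} (1/n)·ln ∏_{j=1}^n (1 − ε·a_j) ≥ ε² or limsup_{n→∞} (1/n)·ln ∏_{j=1}^n (1 + ε·b_j) ≥ ε². -/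
open Filter

lemma aux_log_lower (r : ℝ) (h1 : -(1/2) ≤ r) (h2 : r ≤ 1/2) :
    r - r ^ 2 ≤ Real.log (1 + r) := by
  have hp : 0 < 1 + r := by linarith
  rcases le_total 0 r with h | h
  · have h3 := Real.one_sub_inv_le_log_of_pos hp
    refine le_trans ?_ h3
    have : 1 - (1 + r)⁻¹ = r / (1 + r) := by field_simp; ring
    rw [this, le_div_iff₀ hp]
    nlinarith [pow_nonneg h 3]
  · rw [Real.le_log_iff_exp_le hp]
    have ht : 0 ≤ -(r - r ^ 2) := by nlinarith
    have hq := Real.quadratic_le_exp_of_nonneg ht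
    have he : Real.exp (r - r ^ 2) * Real.exp (-(r - r ^ 2)) = 1 := by
      rw [← Real.exp_add]; simp
    have hpos := Real.exp_pos (-(r - r ^ 2))
    have key : 1 ≤ (1 + r) * (1 + -(r - r ^ 2) + (-(r - r ^ 2)) ^ 2 / 2) := by
      obtain ⟨x, rfl⟩ : ∃ x, r = -x := ⟨-r, by ring⟩
      have hx0 : 0 ≤ x := by linarith
      have hx1 : x ≤ 1 / 2 := by linarith
      have hx2 : x ^ 2 ≤ 1 / 4 := by nlinarith
      have hx3 : x ^ 3 ≤ 1 / 8 := by nlinarith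
      have : 0 ≤ x ^ 2 * (1 - x - x ^ 2 - x ^ 3) :=
        mul_nonneg (sq_nonneg x) (by linarith)
      nlinarith
    have h5 : 1 ≤ (1 + r) * Real.exp (-(r - r ^ 2)) :=
      key.trans (mul_le_mul_of_nonneg_left hq hp.le)
    exact le_of_mul_le_mul_right (he.le.trans h5) hpos

lemma aux_sum (c : ℕ → ℝ) (ε : ℝ) (hε : 0 < ε) (hε' : ε ≤ 1 / 2)
    (hc : ∀ j, |c j| ≤ 1) (n : ℕ) :
    ε * ∑ j ∈ Finset.range n, c j - n * ε ^ 2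
        ≤ Real.log (∏ j ∈ Finset.range n, (1 + ε * c j)) ∧
      Real.log (∏ j ∈ Finset.range n, (1 + ε * c j)) ≤ n * ε := by
  have hr : ∀ j, -ε ≤ ε * c j ∧ ε * c j ≤ ε := fun j => by
    have := abs_le.1 (hc j)
    constructor <;> nlinarith
  rw [Real.log_prod (fun j _ => by have := hr j; linarith)]
  constructor
  · have : ε * ∑ j ∈ Finset.range n, c j - n * ε ^ 2
        = ∑ j ∈ Finset.range n, (ε * c j - ε ^ 2) := by
      rw [Finset.sum_sub_distrib, Finset.mul_sum]; simp
    rw [this]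
    refine Finset.sum_le_sum fun j _ => ?_
    have h := hr j
    have := aux_log_lower (ε * c j) (by linarith) (by linarith)
    have : (ε * c j) ^ 2 ≤ ε ^ 2 := sq_le_sq' h.1 h.2
    linarith
  · have : (n : ℝ) * ε = ∑ j ∈ Finset.range n, ε := by simp
    rw [this]
    refine Finset.sum_le_sum fun j _ => ?_
    have h := hr j
    have := Real.log_le_sub_one_of_pos (show 0 < 1 + ε * c j by linarith)
    linarith

/-- If the averaged differences `(1/n)·∑ (b j − a j)` are eventually at least `δ`,
then the sum of the logarithmic growth rates of the two capital processes
`∏ (1 − ε·a j)` and `∏ (1 + ε·b j)` has limsup at least `ε·δ − 2ε²`; in particular,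
if moreover `ε ≤ δ/8`, at least one of the two processes grows exponentially. -/
theorem limsup_log_prod_ge
    (a b : ℕ → ℝ) (ha : ∀ j, |a j| ≤ 1) (hb : ∀ j, |b j| ≤ 1)
    (δ : ℝ) (hδ : 0 < δ)
    (havg : ∃ N : ℕ, ∀ n ≥ N, δ ≤ (∑ j ∈ Finset.range n, (b j - a j)) / (n : ℝ))
    (ε : ℝ) (hε : 0 < ε) (hε' : ε ≤ 1 / 2) :
    ε * δ - 2 * ε ^ 2 ≤
      limsup (fun n : ℕ =>
        (Real.log (∏ j ∈ Finset.range n, (1 - ε * a j))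
          + Real.log (∏ j ∈ Finset.range n, (1 + ε * b j))) / (n : ℝ)) atTop
    ∧ (ε ≤ δ / 8 →
        ε ^ 2 ≤ limsup (fun n : ℕ =>
            Real.log (∏ j ∈ Finset.range n, (1 - ε * a j)) / (n : ℝ)) atTop
        ∨ ε ^ 2 ≤ limsup (fun n : ℕ =>
            Real.log (∏ j ∈ Finset.range n, (1 + ε * b j)) / (n : ℝ)) atTop) := by
  obtain ⟨N, hN⟩ := havg
  have hA := fun n => aux_sum (fun j => -a j) ε hε hε' (fun j => by simpa using ha j) n
  have hB := fun n => aux_sum b ε hε hε' hb n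
  simp only [mul_neg, ← sub_eq_add_neg, Finset.sum_neg_distrib] at hA
  set A : ℕ → ℝ := fun n => Real.log (∏ j ∈ Finset.range n, (1 - ε * a j)) with hAd
  set B : ℕ → ℝ := fun n => Real.log (∏ j ∈ Finset.range n, (1 + ε * b j)) with hBd
  have hA2 : ∀ᶠ n : ℕ in atTop, A n / n ≤ ε := by
    filter_upwards [eventually_gt_atTop 0] with n hn
    have hn' : (0 : ℝ) < n := by exact_mod_cast hn
    rw [div_le_iff₀ hn']
    linarith [(hA n).2]
  have hB2 : ∀ᶠ n : ℕ in atTop, B n / n ≤ ε := by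
    filter_upwards [eventually_gt_atTop 0] with n hn
    have hn' : (0 : ℝ) < n := by exact_mod_cast hn
    rw [div_le_iff₀ hn']
    linarith [(hB n).2]
  have hlow : ∀ᶠ n : ℕ in atTop, ε * δ - 2 * ε ^ 2 ≤ (A n + B n) / n := by
    filter_upwards [eventually_gt_atTop 0, eventually_ge_atTop N] with n hn hnN
    have hn' : (0 : ℝ) < n := by exact_mod_cast hn
    have h := hN n hnN
    rw [le_div_iff₀ hn', Finset.sum_sub_distrib] at h
    rw [le_div_iff₀ hn']
    have h1 := (hA n).1
    have h2 := (hB n).1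
    have h3 := mul_le_mul_of_nonneg_left h hε.le
    linarith
  have bA : IsBoundedUnder (· ≤ ·) atTop (fun n : ℕ => A n / n) := ⟨ε, by simpa using hA2⟩
  have bB : IsBoundedUnder (· ≤ ·) atTop (fun n : ℕ => B n / n) := ⟨ε, by simpa using hB2⟩
  have bAB : IsBoundedUnder (· ≤ ·) atTop (fun n : ℕ => (A n + B n) / n) := by
    refine ⟨2 * ε, ?_⟩
    rw [eventually_map]
    filter_upwards [hA2, hB2] with n h1 h2
    rw [add_div]; linarith
  refine ⟨le_limsup_of_frequently_le hlow.frequently bAB, fun hεδ => ?_⟩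
  by_contra! hcon
  have e1 := eventually_lt_of_limsup_lt hcon.1 bA
  have e2 := eventually_lt_of_limsup_lt hcon.2 bB
  obtain ⟨n, h1, h2, h3⟩ := (e1.and (e2.and hlow)).exists
  rw [add_div] at h3
  nlinarith
end

section
/- Let C > 0 and let S : [0,1] → ℝ be any function with |S(p)| ≤ C for all p ∈ [0,1]. Then for every Δ > 0 there exists a finitely supported Borel probability measure P on [0,1] such that for each ω ∈ {0,1}, ∫ S(p)·(ω − p) dP(p) ≤ Δ. -/
open Finset

theorem two_point_aux (S : ℝ → ℝ) (Δ a b l : ℝ)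
    (ha : a ∈ Set.Icc (0 : ℝ) 1) (hb : b ∈ Set.Icc (0 : ℝ) 1) (hl0 : 0 ≤ l) (hl1 : l ≤ 1)
    (h : ∀ ω : ℝ, ω = 0 ∨ ω = 1 → l * (S a * (ω - a)) + (1 - l) * (S b * (ω - b)) ≤ Δ) :
    ∃ P : ℝ →₀ ℝ,
      (∀ x, 0 ≤ P x) ∧
      ((P.support : Set ℝ) ⊆ Set.Icc (0 : ℝ) 1) ∧
      (∑ x ∈ P.support, P x = 1) ∧
      ∀ ω : ℝ, ω = 0 ∨ ω = 1 →
        ∑ x ∈ P.support, P x * (S x * (ω - x)) ≤ Δ := by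
  classical
  have key : ∀ f : ℝ → ℝ, ∑ x ∈ (Finsupp.single a l + Finsupp.single b (1 - l)).support,
      (Finsupp.single a l + Finsupp.single b (1 - l)) x * f x = l * f a + (1 - l) * f b := by
    intro f
    change (Finsupp.single a l + Finsupp.single b (1 - l)).sum (fun x w => w * f x) = _
    rw [Finsupp.sum_add_index' (by simp) (by intros; ring),
      Finsupp.sum_single_index (by simp), Finsupp.sum_single_index (by simp)]
  refine ⟨Finsupp.single a l + Finsupp.single b (1 - l), ?_, ?_, ?_, ?_⟩
  · intro x
    rw [Finsupp.add_apply, Finsupp.single_apply, Finsupp.single_apply]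
    split_ifs <;> linarith
  · intro x hx
    by_contra hn
    have h1 : a ≠ x := fun e => hn (e ▸ ha)
    have h2 : b ≠ x := fun e => hn (e ▸ hb)
    have h3 := Finsupp.mem_support_iff.1 (Finset.mem_coe.1 hx)
    rw [Finsupp.add_apply, Finsupp.single_apply, Finsupp.single_apply] at h3
    simp [h1, h2] at h3
  · have := key (fun _ => 1)
    simp only [mul_one] at this
    rw [this]; ring
  · intro ω hω
    rw [key (fun x => S x * (ω - x))]
    exact h ω hω

/-- Finite minimax step: for any bounded function `S` on `[0,1]` and any `Δ > 0`,
there is a finitely supported probability measure `P` on `[0,1]` (represented by its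
weight function `ℝ →₀ ℝ`) such that for each outcome `ω ∈ {0,1}`,
`∫ S(p)(ω − p) dP(p) ≤ Δ` (the integral being a finite sum over the support). -/
theorem exists_finsupp_forecast_measure
    (C : ℝ) (hC : 0 < C)
    (S : ℝ → ℝ) (hS : ∀ p ∈ Set.Icc (0 : ℝ) 1, |S p| ≤ C)
    (Δ : ℝ) (hΔ : 0 < Δ) :
    ∃ P : ℝ →₀ ℝ,
      (∀ x, 0 ≤ P x) ∧
      ((P.support : Set ℝ) ⊆ Set.Icc (0 : ℝ) 1) ∧
      (∑ x ∈ P.support, P x = 1) ∧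
      ∀ ω : ℝ, ω = 0 ∨ ω = 1 →
        ∑ x ∈ P.support, P x * (S x * (ω - x)) ≤ Δ := by
  by_cases h0 : S 0 ≤ 0
  · refine two_point_aux S Δ 0 0 1 (by simp) (by simp) (by simp) le_rfl ?_
    rintro ω (rfl | rfl) <;> linarith
  by_cases h1 : 0 ≤ S 1
  · refine two_point_aux S Δ 1 1 1 (by simp) (by simp) (by simp) le_rfl ?_
    rintro ω (rfl | rfl) <;> linarith
  push Not at h0 h1
  obtain ⟨n, hn⟩ := exists_nat_gt (C / Δ)
  have hn0 : (0 : ℝ) < n := lt_of_le_of_lt (by positivity) hn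
  have hex : ∃ i : ℕ, i < n ∧ 0 < S ((i : ℝ) / n) ∧ S (((i + 1 : ℕ) : ℝ) / n) ≤ 0 := by
    by_contra! hno
    have hall : ∀ i : ℕ, i ≤ n → 0 < S ((i : ℝ) / n) := by
      intro i
      induction i with
      | zero => intro _; simpa using h0
      | succ k ih => intro hk; exact hno k hk (ih (by omega))
    have := hall n le_rfl
    rw [div_self hn0.ne'] at this
    linarith
  obtain ⟨i, hin, hs, ht⟩ := hex
  have hin' : ((i + 1 : ℕ) : ℝ) ≤ n := by exact_mod_cast hin
  have hba : ((i + 1 : ℕ) : ℝ) / n = (i : ℝ) / n + 1 / n := by push_cast; ring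
  have ha0 : (0 : ℝ) ≤ (i : ℝ) / n := by positivity
  have hb1 : ((i + 1 : ℕ) : ℝ) / n ≤ 1 := (div_le_one hn0).2 hin'
  have hd0 : (0 : ℝ) < 1 / n := by positivity
  have hd : C * (1 / n) ≤ Δ := by
    rw [div_lt_iff₀ hΔ] at hn
    rw [mul_one_div, div_le_iff₀ hn0]
    linarith
  generalize ((i + 1 : ℕ) : ℝ) / n = b at *
  generalize (i : ℝ) / n = a at *
  generalize (1 : ℝ) / n = d at *
  have hA : a ∈ Set.Icc (0 : ℝ) 1 := ⟨ha0, by linarith⟩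
  have hB : b ∈ Set.Icc (0 : ℝ) 1 := ⟨by linarith, hb1⟩
  have hsC : S a ≤ C := (abs_le.1 (hS a hA)).2
  have hpos : 0 < S a - S b := by linarith
  obtain ⟨l, hl⟩ : ∃ l, l = -S b / (S a - S b) := ⟨_, rfl⟩
  have hl0 : 0 ≤ l := by rw [hl]; exact div_nonneg (by linarith) hpos.le
  have hl1 : l ≤ 1 := by rw [hl, div_le_one hpos]; linarith
  have hbal : l * S a + (1 - l) * S b = 0 := by
    rw [hl]; field_simp; ring
  have hls : l * S a ≤ C := by nlinarith
  have hfin : l * S a * d ≤ Δ := (mul_le_mul_of_nonneg_right hls hd0.le).trans hd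
  refine two_point_aux S Δ a b l hA hB hl0 hl1 ?_
  intro ω _
  have : l * (S a * (ω - a)) + (1 - l) * (S b * (ω - b)) = l * S a * d := by
    have hdd : d = b - a := by linarith
    rw [hdd]
    linear_combination (ω - b) * hbal
  rw [this]
  exact hfin
end

section
/- Let S : [0,1] → ℝ be a continuous function. Then there exists a Borel probability measure P on [0,1] such that for each ω ∈ {0,1}, ∫ S(p)·(ω − p) dP(p) ≤ 0. -/
open MeasureTheory

/-- Limiting step of Vovk and Shafer's Theorem 1: for any continuous function `S` on
`[0,1]` there is a Borel probability measure `P` on `[0,1]` such that for each outcome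
`ω ∈ {0,1}`, `∫ S(p)(ω − p) dP(p) ≤ 0`. -/
theorem exists_neutral_forecast_measure
    (S : Set.Icc (0 : ℝ) 1 → ℝ) (hS : Continuous S) :
    ∃ P : Measure (Set.Icc (0 : ℝ) 1), IsProbabilityMeasure P ∧
      ∀ ω : ℝ, ω = 0 ∨ ω = 1 → ∫ p, S p * (ω - (p : ℝ)) ∂P ≤ 0 := by
  obtain ⟨q, h0, h1⟩ : ∃ q : Set.Icc (0 : ℝ) 1,
      S q * (0 - (q : ℝ)) ≤ 0 ∧ S q * (1 - (q : ℝ)) ≤ 0 := by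
    by_cases ha : S 0 ≤ 0
    · exact ⟨0, by simp, by simpa using ha⟩
    by_cases hb : 0 ≤ S 1
    · exact ⟨1, by simpa using hb, by simp⟩
    obtain ⟨q, hq⟩ : (0 : ℝ) ∈ Set.range S :=
      mem_range_of_exists_le_of_exists_ge hS ⟨1, (not_le.mp hb).le⟩ ⟨0, (not_le.mp ha).le⟩
    exact ⟨q, by simp [hq], by simp [hq]⟩
  refine ⟨Measure.dirac q, inferInstance, ?_⟩
  rintro ω (rfl | rfl)
  · rw [integral_dirac]; exact h0
  · rw [integral_dirac]; exact h1
end
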